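/- Fix a probability measure P on (Ω, 𝒢), a filtration (𝓕_t)_{t∈[0,T]}, and T > 0. Let M be an (𝓕_t)-adapted process with continuous paths and M_t square-integrable under P for every t ∈ [0,T]. Let Q and A be (𝓕_t)-adapted, P-integrable processes with continuous nondecreasing paths and Q_0 = A_0 = 0. Assume that under P: M is a martingale, M² − Q is a martingale, and M² − A is a supermartingale with respect to (𝓕_t). Then P-almost surely, Q_t − Q_s ≤ A_t − A_s for all 0 ≤ s ≤ t ≤ T; i.e., A − Q has nondecreasing paths P-a.s. -/

import Mathlib

open MeasureTheory Filter Set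
open scoped ENNReal

/-- One-sided Huber function. -/
noncomputable def hubF (x : ℝ) : ℝ :=
  min (max (-x) 0) 1 * max (-x) 0 - (min (max (-x) 0) 1) ^ 2 / 2

/-- Minus its derivative. -/
noncomputable def hubG (x : ℝ) : ℝ := min (max (-x) 0) 1

lemma hubG_nonneg (x : ℝ) : 0 ≤ hubG x := by unfold hubG; positivity

lemma hubG_le_one (x : ℝ) : hubG x ≤ 1 := min_le_right _ _

lemma hubF_continuous : Continuous hubF := by unfold hubF; fun_prop

lemma hubG_continuous : Continuous hubG := by unfold hubG; fun_prop

lemma hub_cases (x : ℝ) : (0 ≤ x ∧ hubF x = 0 ∧ hubG x = 0) ∨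
    (x ≤ 0 ∧ -1 ≤ x ∧ hubF x = x ^ 2 / 2 ∧ hubG x = -x) ∨
    (x ≤ -1 ∧ hubF x = -x - 1 / 2 ∧ hubG x = 1) := by
  rcases le_total 0 x with h | h
  · left
    have h1 : max (-x) 0 = 0 := max_eq_right (by linarith)
    refine ⟨h, ?_, ?_⟩ <;> simp [hubF, hubG, h1]
  · have h1 : max (-x) 0 = -x := max_eq_left (by linarith)
    rcases le_total (-1) x with h' | h'
    · right; left
      have h2 : min (-x) 1 = -x := min_eq_left (by linarith)
      refine ⟨h, h', ?_, ?_⟩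
      · simp only [hubF, h1, h2]; ring
      · simp only [hubG, h1, h2]
    · right; right
      have h2 : min (-x) 1 = 1 := min_eq_right (by linarith)
      refine ⟨h', ?_, ?_⟩
      · simp only [hubF, h1, h2]; ring
      · simp only [hubG, h1, h2]

lemma hubF_nonneg (x : ℝ) : 0 ≤ hubF x := by
  rcases hub_cases x with ⟨h, e, -⟩ | ⟨h, h', e, -⟩ | ⟨h, e, -⟩ <;> rw [e]
  · positivity
  · linarith

lemma nonneg_of_hubF (x : ℝ) (hx : hubF x = 0) : 0 ≤ x := by
  rcases hub_cases x with ⟨h, e, -⟩ | ⟨h, h', e, -⟩ | ⟨h, e, -⟩ <;> rw [e] at hx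
  · exact h
  · have : x = 0 := by nlinarith
    exact this.ge
  · linarith

lemma hubF_le (x : ℝ) : hubF x ≤ |x| := by
  rcases hub_cases x with ⟨h, e, -⟩ | ⟨h, h', e, -⟩ | ⟨h, e, -⟩ <;> rw [e]
  · positivity
  · rw [abs_of_nonpos h]; nlinarith
  · rw [abs_of_nonpos (by linarith)]; linarith

/-- Taylor remainder. -/
noncomputable def hubR (x y : ℝ) : ℝ := hubF y - hubF x + hubG x * (y - x)

lemma hubR_nonneg (x y : ℝ) : 0 ≤ hubR x y := by
  unfold hubR
  rcases hub_cases x with ⟨h, e, f⟩ | ⟨h, h', e, f⟩ | ⟨h, e, f⟩ <;>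
  rcases hub_cases y with ⟨h1, e1, -⟩ | ⟨h1, h1', e1, -⟩ | ⟨h1, e1, -⟩ <;> rw [e, f, e1] <;>
  nlinarith [sq_nonneg (x - y), sq_nonneg (y + 1), sq_nonneg (x + 1)]

lemma hubR_le_sq (x y : ℝ) : hubR x y ≤ (y - x) ^ 2 := by
  unfold hubR
  rcases hub_cases x with ⟨h, e, f⟩ | ⟨h, h', e, f⟩ | ⟨h, e, f⟩ <;>
  rcases hub_cases y with ⟨h1, e1, -⟩ | ⟨h1, h1', e1, -⟩ | ⟨h1, e1, -⟩ <;> rw [e, f, e1] <;>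
  nlinarith [sq_nonneg (x - y), sq_nonneg (y + 1), sq_nonneg (x + 1), sq_nonneg (y - x - 1),
    sq_nonneg (y - x + 1), sq_nonneg x, sq_nonneg y]

lemma hubR_le_abs (x y : ℝ) : hubR x y ≤ |y - x| := by
  unfold hubR
  rcases hub_cases x with ⟨h, e, f⟩ | ⟨h, h', e, f⟩ | ⟨h, e, f⟩ <;>
  rcases hub_cases y with ⟨h1, e1, -⟩ | ⟨h1, h1', e1, -⟩ | ⟨h1, e1, -⟩ <;> rw [e, f, e1] <;>
  rcases le_total 0 (y - x) with h2 | h2 <;>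
  simp only [abs_of_nonneg, abs_of_nonpos, h2] <;> 
  nlinarith [sq_nonneg (x - y), sq_nonneg (y + 1), sq_nonneg (x + 1)]

lemma hubR_continuous : Continuous fun p : ℝ × ℝ => hubR p.1 p.2 := by
  unfold hubR
  have := hubF_continuous
  have := hubG_continuous
  fun_prop

set_option maxHeartbeats 1000000 in
/-- Key step: a continuous submartingale `X` whose increments are dominated by those of an
integrable nondecreasing continuous process `V` has nonnegative increments. -/
lemma key_step {Ω : Type*} {mΩ : MeasurableSpace Ω} (μ : Measure Ω) [IsProbabilityMeasure μ]
    (X V : ℝ → Ω → ℝ) (s t : ℝ) (hst : s ≤ t)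
    (hXint : ∀ u ∈ Icc s t, Integrable (X u) μ)
    (hVint : ∀ u ∈ Icc s t, Integrable (V u) μ)
    (hVcont : ∀ ω, ContinuousOn (fun u => V u ω) (Icc s t))
    (hXV : ∀ ω, ∀ u ∈ Icc s t, ∀ v ∈ Icc s t, u ≤ v → |X v ω - X u ω| ≤ V v ω - V u ω)
    (hsub : ∀ u ∈ Icc s t, ∀ v ∈ Icc s t, u ≤ v →
      0 ≤ ∫ ω, hubG (X u ω - X s ω) * (X v ω - X u ω) ∂μ) :
    ∀ᵐ ω ∂μ, X s ω ≤ X t ω := by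
  classical
  set τ : ℕ → ℕ → ℝ := fun n i => s + (i : ℝ) / (n + 1 : ℝ) * (t - s) with hτ
  have hτ0 : ∀ n, τ n 0 = s := by intro n; simp [hτ]
  have hτ1 : ∀ n, τ n (n + 1) = t := by
    intro n
    have : (n + 1 : ℝ) ≠ 0 := by positivity
    simp [hτ, this]
  have hτs : ∀ n i, τ n (i + 1) - τ n i = (t - s) / (n + 1 : ℝ) := by
    intro n i; simp only [hτ]; push_cast; ring
  have hτm : ∀ n, Monotone (τ n) := by
    intro n
    refine monotone_nat_of_le_succ fun i => ?_
    have h1 := hτs n i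
    have : 0 ≤ (t - s) / (n + 1 : ℝ) := div_nonneg (by linarith) (by positivity)
    linarith
  have hτmem : ∀ n i, i ≤ n + 1 → τ n i ∈ Icc s t := fun n i hi =>
    ⟨(hτ0 n) ▸ hτm n (Nat.zero_le i), (hτ1 n) ▸ hτm n hi⟩
  have hs : s ∈ Icc s t := left_mem_Icc.2 hst
  have ht : t ∈ Icc s t := right_mem_Icc.2 hst
  set R : ℕ → Ω → ℝ := fun n ω => ∑ i ∈ Finset.range (n + 1),
    hubR (X (τ n i) ω - X s ω) (X (τ n (i + 1)) ω - X s ω) with hR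
  have hVsum : ∀ n ω, ∑ i ∈ Finset.range (n + 1), (V (τ n (i + 1)) ω - V (τ n i) ω)
      = V t ω - V s ω := by
    intro n ω
    rw [Finset.sum_range_sub (fun i => V (τ n i) ω), hτ0, hτ1]
  have hinc : ∀ n ω, ∀ i ∈ Finset.range (n + 1),
      |X (τ n (i + 1)) ω - X s ω - (X (τ n i) ω - X s ω)|
        ≤ V (τ n (i + 1)) ω - V (τ n i) ω := by
    intro n ω i hi
    have hi' := Finset.mem_range.1 hi
    rw [sub_sub_sub_cancel_right]
    exact hXV ω _ (hτmem n i (by omega)) _ (hτmem n (i + 1) (by omega)) (hτm n (Nat.le_succ i))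
  have hR0 : ∀ n ω, 0 ≤ R n ω := fun n ω => Finset.sum_nonneg fun i _ => hubR_nonneg _ _
  have hRV : ∀ n ω, R n ω ≤ V t ω - V s ω := by
    intro n ω
    rw [← hVsum n ω]
    exact Finset.sum_le_sum fun i hi => (hubR_le_abs _ _).trans (hinc n ω i hi)
  have hRlim : ∀ ω, Tendsto (fun n => R n ω) atTop (nhds 0) := by
    intro ω
    have huc := isCompact_Icc.uniformContinuousOn_of_continuous (hVcont ω)
    rw [Metric.uniformContinuousOn_iff] at huc
    have hW : 0 ≤ V t ω - V s ω := (abs_nonneg _).trans (hXV ω s hs t ht hst)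
    rw [Metric.tendsto_atTop]
    intro ε hε
    set η := ε / (V t ω - V s ω + 1) with hη
    have hηpos : 0 < η := by positivity
    obtain ⟨δ, hδ, hd⟩ := huc η hηpos
    have hlim : Tendsto (fun n : ℕ => (t - s) / (n + 1 : ℝ)) atTop (nhds 0) := by
      have := (tendsto_one_div_add_atTop_nhds_zero_nat (𝕜 := ℝ)).const_mul (t - s)
      simpa [div_eq_mul_inv] using this
    obtain ⟨N, hN⟩ := (Metric.tendsto_atTop.1 hlim) δ hδ
    refine ⟨N, fun n hn => ?_⟩
    have hle : R n ω ≤ η * (V t ω - V s ω) := by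
      rw [← hVsum n ω, Finset.mul_sum]
      refine Finset.sum_le_sum fun i hi => (hubR_le_sq _ _).trans ?_
      have h1 := hinc n ω i hi
      have hi' := Finset.mem_range.1 hi
      have h2 := hd _ (hτmem n (i + 1) (by omega)) _ (hτmem n i (by omega))
        (by have h5 := hN n hn
            rw [Real.dist_eq, sub_zero] at h5
            rw [Real.dist_eq, hτs]; exact h5)
      rw [Real.dist_eq] at h2
      have h3 := (le_abs_self _).trans h2.le
      rw [← sq_abs]
      have h4 := abs_nonneg (X (τ n (i + 1)) ω - X s ω - (X (τ n i) ω - X s ω))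
      nlinarith
    rw [Real.dist_eq, sub_zero, abs_of_nonneg (hR0 n ω)]
    refine hle.trans_lt ?_
    rw [hη, div_mul_eq_mul_div, div_lt_iff₀ (by positivity)]
    nlinarith
  have hRmeas : ∀ n, AEStronglyMeasurable (R n) μ := by
    intro n
    refine Finset.aestronglyMeasurable_fun_sum _ fun i hi => ?_
    have hi' := Finset.mem_range.1 hi
    have hm1 : AEStronglyMeasurable (fun ω => X (τ n i) ω - X s ω) μ :=
      ((hXint _ (hτmem n i (by omega))).sub (hXint s hs)).aestronglyMeasurable
    have hm2 : AEStronglyMeasurable (fun ω => X (τ n (i + 1)) ω - X s ω) μ :=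
      ((hXint _ (hτmem n (i + 1) (by omega))).sub (hXint s hs)).aestronglyMeasurable
    exact hubR_continuous.comp_aestronglyMeasurable (hm1.prodMk hm2)
  have hWint : Integrable (fun ω => V t ω - V s ω) μ := (hVint t ht).sub (hVint s hs)
  have hRint : ∀ n, Integrable (R n) μ := fun n => hWint.mono' (hRmeas n)
    (ae_of_all _ fun ω => by rw [Real.norm_eq_abs, abs_of_nonneg (hR0 n ω)]; exact hRV n ω)
  have hlim : Tendsto (fun n => ∫ ω, R n ω ∂μ) atTop (nhds 0) := by
    have := tendsto_integral_of_dominated_convergence (F := R) (f := fun _ => (0 : ℝ)) (μ := μ)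
      (fun ω => V t ω - V s ω) hRmeas hWint
      (fun n => ae_of_all _ fun ω => by
        rw [Real.norm_eq_abs, abs_of_nonneg (hR0 n ω)]; exact hRV n ω)
      (ae_of_all _ hRlim)
    simpa using this
  have hFint : Integrable (fun ω => hubF (X t ω - X s ω)) μ :=
    ((hXint t ht).sub (hXint s hs)).abs.mono'
      (hubF_continuous.comp_aestronglyMeasurable
        ((hXint t ht).sub (hXint s hs)).aestronglyMeasurable)
      (ae_of_all _ fun ω => by
        rw [Real.norm_eq_abs, abs_of_nonneg (hubF_nonneg _)]; exact hubF_le _)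
  have hGint : ∀ u ∈ Icc s t, ∀ v ∈ Icc s t,
      Integrable (fun ω => hubG (X u ω - X s ω) * (X v ω - X u ω)) μ := by
    intro u hu v hv
    refine ((hXint v hv).sub (hXint u hu)).bdd_mul (c := 1)
      (hubG_continuous.comp_aestronglyMeasurable
        ((hXint u hu).sub (hXint s hs)).aestronglyMeasurable) (ae_of_all _ fun ω => ?_)
    rw [Real.norm_eq_abs, abs_of_nonneg (hubG_nonneg _)]
    exact hubG_le_one _
  have hbound : ∀ n, ∫ ω, hubF (X t ω - X s ω) ∂μ ≤ ∫ ω, R n ω ∂μ := by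
    intro n
    have hid : ∀ ω, R n ω = hubF (X t ω - X s ω) + ∑ i ∈ Finset.range (n + 1),
        hubG (X (τ n i) ω - X s ω) * (X (τ n (i + 1)) ω - X (τ n i) ω) := by
      intro ω
      have h0 : hubF 0 = 0 := by simp [hubF]
      simp only [hR, hubR, sub_sub_sub_cancel_right]
      rw [Finset.sum_add_distrib,
        Finset.sum_range_sub (fun i => hubF (X (τ n i) ω - X s ω)), hτ0, hτ1, sub_self, h0,
        sub_zero]
    have hGi : ∀ i ∈ Finset.range (n + 1), Integrable (fun ω =>
        hubG (X (τ n i) ω - X s ω) * (X (τ n (i + 1)) ω - X (τ n i) ω)) μ := by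
      intro i hi
      have hi' := Finset.mem_range.1 hi
      exact hGint _ (hτmem n i (by omega)) _ (hτmem n (i + 1) (by omega))
    simp_rw [hid]
    rw [integral_add hFint (integrable_finset_sum _ hGi), integral_finset_sum _ hGi]
    have : 0 ≤ ∑ i ∈ Finset.range (n + 1), ∫ ω,
        hubG (X (τ n i) ω - X s ω) * (X (τ n (i + 1)) ω - X (τ n i) ω) ∂μ := by
      refine Finset.sum_nonneg fun i hi => ?_
      have hi' := Finset.mem_range.1 hi
      exact hsub _ (hτmem n i (by omega)) _ (hτmem n (i + 1) (by omega)) (hτm n (Nat.le_succ i))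
    linarith
  have hle0 : ∫ ω, hubF (X t ω - X s ω) ∂μ ≤ 0 := ge_of_tendsto' hlim hbound
  have heq : ∫ ω, hubF (X t ω - X s ω) ∂μ = 0 :=
    le_antisymm hle0 (integral_nonneg fun ω => hubF_nonneg _)
  rw [integral_eq_zero_iff_of_nonneg (fun ω => hubF_nonneg _) hFint] at heq
  filter_upwards [heq] with ω hω
  have := nonneg_of_hubF _ hω
  linarith

/-- If, under `P`, `M` is a continuous martingale, `M² - Q` is a martingale and `M² - A` is a
supermartingale, where `Q` and `A` are continuous nondecreasing adapted processes starting
at `0`, then `P`-a.s. the increments of `Q` are dominated by those of `A` on `[0,T]`: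
`Q_t - Q_s ≤ A_t - A_s` for all `0 ≤ s ≤ t ≤ T` (i.e. `d⟨M⟩ ≤ dA`). -/
theorem quadratic_variation_increment_domination {Ω : Type*} {mΩ : MeasurableSpace Ω}
    (𝓕 : Filtration ℝ mΩ)
    (μ : Measure Ω) [IsProbabilityMeasure μ]
    (T : ℝ) (hT : 0 < T)
    (M Q A : ℝ → Ω → ℝ)
    (hMadapt : ∀ t ∈ Set.Icc (0:ℝ) T, StronglyMeasurable[𝓕 t] (M t))
    (hQadapt : ∀ t ∈ Set.Icc (0:ℝ) T, StronglyMeasurable[𝓕 t] (Q t))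
    (hAadapt : ∀ t ∈ Set.Icc (0:ℝ) T, StronglyMeasurable[𝓕 t] (A t))
    (hMcont : ∀ ω, ContinuousOn (fun t => M t ω) (Set.Icc 0 T))
    (hQcont : ∀ ω, ContinuousOn (fun t => Q t ω) (Set.Icc 0 T))
    (hAcont : ∀ ω, ContinuousOn (fun t => A t ω) (Set.Icc 0 T))
    (hQmono : ∀ ω, MonotoneOn (fun t => Q t ω) (Set.Icc 0 T))
    (hAmono : ∀ ω, MonotoneOn (fun t => A t ω) (Set.Icc 0 T))
    (hQ0 : ∀ ω, Q 0 ω = 0) (hA0 : ∀ ω, A 0 ω = 0)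
    (hMint : ∀ t ∈ Set.Icc (0:ℝ) T, Integrable (fun ω => (M t ω) ^ 2) μ)
    (hQint : ∀ t ∈ Set.Icc (0:ℝ) T, Integrable (Q t) μ)
    (hAint : ∀ t ∈ Set.Icc (0:ℝ) T, Integrable (A t) μ)
    (hMmart : ∀ s t : ℝ, 0 ≤ s → s ≤ t → t ≤ T → (μ[M t | 𝓕 s]) =ᵐ[μ] M s)
    (hMQmart : ∀ s t : ℝ, 0 ≤ s → s ≤ t → t ≤ T →
      (μ[fun ω => (M t ω) ^ 2 - Q t ω | 𝓕 s]) =ᵐ[μ] fun ω => (M s ω) ^ 2 - Q s ω)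
    (hMAsuper : ∀ s t : ℝ, 0 ≤ s → s ≤ t → t ≤ T →
      ∀ᵐ ω ∂μ, (μ[fun ω => (M t ω) ^ 2 - A t ω | 𝓕 s]) ω ≤ (M s ω) ^ 2 - A s ω) :
    ∀ᵐ ω ∂μ, ∀ s t : ℝ, 0 ≤ s → s ≤ t → t ≤ T → Q t ω - Q s ω ≤ A t ω - A s ω := by
  set X : ℝ → Ω → ℝ := fun u ω => A u ω - Q u ω with hX
  have hXint : ∀ u ∈ Icc (0:ℝ) T, Integrable (X u) μ := fun u hu => (hAint u hu).sub (hQint u hu)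
  have hXad : ∀ u ∈ Icc (0:ℝ) T, StronglyMeasurable[𝓕 u] (X u) :=
    fun u hu => (hAadapt u hu).sub (hQadapt u hu)
  -- submartingale property
  have hsubm : ∀ u v : ℝ, 0 ≤ u → u ≤ v → v ≤ T →
      ∀ᵐ ω ∂μ, 0 ≤ (μ[fun ω => X v ω - X u ω | 𝓕 u]) ω := by
    intro u v h0 huv hvT
    have hu : u ∈ Icc (0:ℝ) T := ⟨h0, huv.trans hvT⟩
    have hv : v ∈ Icc (0:ℝ) T := ⟨h0.trans huv, hvT⟩
    have e1 := condExp_sub (m := 𝓕 u) ((hMint v hv).sub (hQint v hv))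
      ((hMint v hv).sub (hAint v hv))
    have e2 := condExp_sub (m := 𝓕 u) (hXint v hv) (hXint u hu)
    have e3 : μ[X u | 𝓕 u] = X u :=
      condExp_of_stronglyMeasurable (𝓕.le u) (hXad u hu) (hXint u hu)
    have e4 : (((fun ω => M v ω ^ 2) - Q v) - ((fun ω => M v ω ^ 2) - A v)) = X v := by
      funext ω; simp [hX]
    rw [e4] at e1
    filter_upwards [e1, e2, hMQmart u v h0 huv hvT, hMAsuper u v h0 huv hvT]
      with ω h1 h2 h3 h4
    change (μ[X v - X u | 𝓕 u]) ω = _ at h2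
    change 0 ≤ (μ[X v - X u | 𝓕 u]) ω
    rw [h2, Pi.sub_apply, h1, e3, Pi.sub_apply]
    change (μ[(fun ω => M v ω ^ 2) - Q v | 𝓕 u]) ω = _ at h3
    change (μ[(fun ω => M v ω ^ 2) - A v | 𝓕 u]) ω ≤ _ at h4
    simp only [hX]
    linarith
  have hpair : ∀ s t : ℝ, 0 ≤ s → s ≤ t → t ≤ T → ∀ᵐ ω ∂μ, X s ω ≤ X t ω := by
    intro s t h0 hst htT
    have hmem : ∀ u ∈ Icc s t, u ∈ Icc (0:ℝ) T := fun u hu =>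
      ⟨h0.trans hu.1, hu.2.trans htT⟩
    refine key_step μ X (fun u ω => A u ω + Q u ω) s t hst (fun u hu => hXint u (hmem u hu))
      (fun u hu => (hAint u (hmem u hu)).add (hQint u (hmem u hu)))
      (fun ω => ((hAcont ω).add (hQcont ω)).mono hmem) ?_ ?_
    · intro ω u hu v hv huv
      have h1 := hAmono ω (hmem u hu) (hmem v hv) huv
      have h2 := hQmono ω (hmem u hu) (hmem v hv) huv
      simp only [hX] at *
      rw [abs_le]
      constructor <;> linarith
    · intro u hu v hv huv
      have hu' := hmem u hu
      have hv' := hmem v hv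
      have hs' : s ∈ Icc (0:ℝ) T := ⟨h0, hst.trans htT⟩
      have hGm : StronglyMeasurable[𝓕 u] (fun ω => hubG (X u ω - X s ω)) :=
        hubG_continuous.comp_stronglyMeasurable
          ((hXad u hu').sub ((hXad s hs').mono (𝓕.mono hu.1)))
      have hD : Integrable (fun ω => X v ω - X u ω) μ := (hXint v hv').sub (hXint u hu')
      have hGD : Integrable (fun ω => hubG (X u ω - X s ω) * (X v ω - X u ω)) μ := by
        refine hD.bdd_mul (c := 1) (hGm.mono (𝓕.le u)).aestronglyMeasurable
          (ae_of_all _ fun ω => ?_)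
        rw [Real.norm_eq_abs, abs_of_nonneg (hubG_nonneg _)]
        exact hubG_le_one _
      rw [← integral_condExp (𝓕.le u)]
      have hpull := condExp_mul_of_stronglyMeasurable_left hGm hGD hD
      refine integral_nonneg_of_ae ?_
      filter_upwards [hpull, hsubm u v hu'.1 huv hv'.2] with ω h1 h2
      change 0 ≤ (μ[(fun ω => hubG (X u ω - X s ω)) * (fun ω => X v ω - X u ω) | 𝓕 u]) ω
      rw [h1]
      exact mul_nonneg (hubG_nonneg _) h2
  -- pass to all times simultaneously
  have hall : ∀ᵐ ω ∂μ, ∀ p q : ℚ,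
      X (projIcc 0 T hT.le (p : ℝ)) ω ≤ X (projIcc 0 T hT.le (max (p : ℝ) (q : ℝ))) ω := by
    rw [ae_all_iff]; intro p
    rw [ae_all_iff]; intro q
    exact hpair _ _ (projIcc 0 T hT.le (p : ℝ)).2.1
      (monotone_projIcc hT.le (le_max_left _ _)) (projIcc 0 T hT.le (max (p : ℝ) (q : ℝ))).2.2
  filter_upwards [hall] with ω hω s t h0 hst htT
  have hXc : Continuous fun r : ℝ => X (projIcc 0 T hT.le r) ω := by
    have h1 : ContinuousOn (fun u => X u ω) (Icc 0 T) := (hAcont ω).sub (hQcont ω)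
    exact (continuousOn_iff_continuous_domRestrict.1 h1).comp continuous_projIcc
  have hmain : ∀ a b : ℝ,
      X (projIcc 0 T hT.le a) ω ≤ X (projIcc 0 T hT.le (max a b)) ω := by
    intro a b
    refine Rat.denseRange_cast.induction_on₂
      (p := fun a b : ℝ => X (projIcc 0 T hT.le a) ω ≤ X (projIcc 0 T hT.le (max a b)) ω)
      ?_ (fun p q => hω p q) a b
    exact isClosed_le (hXc.comp continuous_fst)
      (hXc.comp (continuous_fst.max continuous_snd))
  have := hmain s t
  rw [max_eq_right hst, projIcc_of_mem hT.le (⟨h0, hst.trans htT⟩ : s ∈ Icc 0 T),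
    projIcc_of_mem hT.le (⟨h0.trans hst, htT⟩ : t ∈ Icc 0 T)] at this
  simp only [hX] at this
  linarith
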